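/- arXiv:math/0610941 — 4 statements merged into one kernel-verified Lean document; each statement's English description precedes it below -/
import Mathlib

section
/- Let Δ be a simplicial complex with shelling F_1, …, F_q and let σ be a face of Δ. Then the link link_Δ σ = {τ ∈ Δ : τ ∩ σ = ∅ and τ ∪ σ ∈ Δ} is shellable; indeed, the facets of link_Δ σ are exactly the sets F_i − σ for those facets F_i of Δ containing σ, and listing them in order of increasing index i is a shelling of link_Δ σ. -/
variable {α : Type*}

/-- A (finite) simplicial complex: a collection of finite sets closed under subsets. -/
def IsSimplicialComplex (Δ : Finset (Finset α)) : Prop :=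
  ∀ F ∈ Δ, ∀ G : Finset α, G ⊆ F → G ∈ Δ

/-- A facet is a maximal face. -/
def IsFacet (Δ : Finset (Finset α)) (F : Finset α) : Prop :=
  F ∈ Δ ∧ ∀ G ∈ Δ, F ⊆ G → G = F

/-- `F : Fin q → Finset α` is a shelling order for `Δ`: it enumerates the facets of `Δ`
without repetition, and for each `k` every maximal element of the complex
`(⋃_{i<k} 2^{F i}) ∩ 2^{F k}` has cardinality `|F k| - 1`. -/
def IsShelling (Δ : Finset (Finset α)) {q : ℕ} (F : Fin q → Finset α) : Prop :=
  Function.Injective F ∧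
  (∀ G : Finset α, IsFacet Δ G ↔ ∃ i, F i = G) ∧
  ∀ k : Fin q, ∀ G : Finset α,
    (G ⊆ F k ∧ ∃ i, i < k ∧ G ⊆ F i) →
    (∀ G' : Finset α, (G' ⊆ F k ∧ ∃ i, i < k ∧ G' ⊆ F i) → G ⊆ G' → G' = G) →
    G.card = (F k).card - 1

/-- The link of a face `σ` in `Δ`. -/
def linkComplex [DecidableEq α] (Δ : Finset (Finset α)) (σ : Finset α) : Finset (Finset α) :=
  Δ.filter (fun τ => τ ∩ σ = ∅ ∧ τ ∪ σ ∈ Δ)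

theorem mem_linkComplex [DecidableEq α] {Δ : Finset (Finset α)} {σ τ : Finset α} :
    τ ∈ linkComplex Δ σ ↔ τ ∈ Δ ∧ τ ∩ σ = ∅ ∧ τ ∪ σ ∈ Δ := by
  simp [linkComplex]

theorem sdiff_mem_linkComplex [DecidableEq α] {Δ : Finset (Finset α)}
    (hΔ : IsSimplicialComplex Δ) {σ H : Finset α} (hH : H ∈ Δ) (hσ : σ ⊆ H) :
    H \ σ ∈ linkComplex Δ σ :=
  mem_linkComplex.2 ⟨hΔ H hH _ Finset.sdiff_subset, Finset.sdiff_inter_self _ _,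
    by rwa [Finset.sdiff_union_of_subset hσ]⟩

/-- The facets of the link of `σ` are the sets `H \ σ` for the facets `H` containing `σ`. -/
theorem isFacet_linkComplex_iff [DecidableEq α] {Δ : Finset (Finset α)}
    (hΔ : IsSimplicialComplex Δ) {σ G : Finset α} :
    IsFacet (linkComplex Δ σ) G ↔ ∃ H, IsFacet Δ H ∧ σ ⊆ H ∧ G = H \ σ := by
  constructor
  · rintro ⟨hG, hmax⟩
    obtain ⟨-, hdisj, hunion⟩ := mem_linkComplex.1 hG
    have hdisj' : Disjoint G σ := Finset.disjoint_iff_inter_eq_empty.2 hdisj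
    refine ⟨G ∪ σ, ⟨hunion, fun H hH hsub => ?_⟩, Finset.subset_union_right,
      (Finset.union_sdiff_cancel_right hdisj').symm⟩
    obtain ⟨hGH, hσH⟩ := Finset.union_subset_iff.1 hsub
    rw [← hmax _ (sdiff_mem_linkComplex hΔ hH hσH) (Finset.subset_sdiff.2 ⟨hGH, hdisj'⟩),
      Finset.sdiff_union_of_subset hσH]
  · rintro ⟨H, ⟨hH, hmax⟩, hσH, rfl⟩
    refine ⟨sdiff_mem_linkComplex hΔ hH hσH, fun K hK hsub => ?_⟩
    obtain ⟨-, hdisj, hunion⟩ := mem_linkComplex.1 hK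
    rw [← hmax _ hunion ((sdiff_le_iff.1 hsub).trans_eq (Finset.union_comm _ _)),
      Finset.union_sdiff_cancel_right (Finset.disjoint_iff_inter_eq_empty.2 hdisj)]

/-- Listing the facets that contain `σ` in the order of a shelling and removing `σ` from each
gives a shelling of the link of `σ`. -/
theorem IsShelling.linkComplex [DecidableEq α] {Δ : Finset (Finset α)}
    (hΔ : IsSimplicialComplex Δ) {q n : ℕ} {F : Fin q → Finset α} (hF : IsShelling Δ F)
    {σ : Finset α} {e : Fin n → Fin q} (he : StrictMono e)
    (hrange : ∀ i, σ ⊆ F i ↔ ∃ j, e j = i) :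
    IsShelling (linkComplex Δ σ) (fun j => F (e j) \ σ) := by
  obtain ⟨hinj, hfacet, hshell⟩ := hF
  have hσ : ∀ j, σ ⊆ F (e j) := fun j => (hrange _).2 ⟨j, rfl⟩
  refine ⟨fun a b hab => ?_, fun G => ?_, ?_⟩
  · apply he.injective
    apply hinj
    rw [← Finset.sdiff_union_of_subset (hσ a), ← Finset.sdiff_union_of_subset (hσ b)]
    exact congrArg (· ∪ σ) hab
  · rw [isFacet_linkComplex_iff hΔ]
    constructor
    · rintro ⟨H, hH, hσH, rfl⟩
      obtain ⟨i, rfl⟩ := (hfacet H).1 hH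
      obtain ⟨j, rfl⟩ := (hrange i).1 hσH
      exact ⟨j, rfl⟩
    · rintro ⟨j, rfl⟩
      exact ⟨F (e j), (hfacet _).2 ⟨_, rfl⟩, hσ j, rfl⟩
  · rintro k G ⟨hGk, i, hik, hGi⟩ hmax
    obtain ⟨hGFk, hdisj⟩ := Finset.subset_sdiff.1 hGk
    have hcard := hshell (e k) (G ∪ σ)
      ⟨Finset.union_subset hGFk (hσ k), e i, he hik,
        Finset.union_subset (Finset.subset_sdiff.1 hGi).1 (hσ i)⟩ ?_
    · rw [Finset.card_union_of_disjoint hdisj] at hcard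
      rw [Finset.card_sdiff_of_subset (hσ k)]
      omega
    · rintro H ⟨hHk, l, hlk, hHl⟩ hsub
      obtain ⟨hGH, hσH⟩ := Finset.union_subset_iff.1 hsub
      obtain ⟨m, rfl⟩ := (hrange l).1 (hσH.trans hHl)
      rw [← hmax (H \ σ) ⟨Finset.sdiff_subset_sdiff hHk subset_rfl, m, he.lt_iff_lt.1 hlk,
        Finset.sdiff_subset_sdiff hHl subset_rfl⟩ (Finset.subset_sdiff.2 ⟨hGH, hdisj⟩),
        Finset.sdiff_union_of_subset hσH]

/-- if `F_1, …, F_q` is a shelling of `Δ` and `σ ∈ Δ`, then the facets of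
`link_Δ σ` are exactly the sets `F i \ σ` for the facets `F i ⊇ σ`, and listing them in order
of increasing index is a shelling of `link_Δ σ`. -/
theorem statement1 [DecidableEq α] (Δ : Finset (Finset α)) (hΔ : IsSimplicialComplex Δ)
    {q : ℕ} (F : Fin q → Finset α) (hF : IsShelling Δ F) (σ : Finset α) (hσ : σ ∈ Δ) :
    (∀ G : Finset α, IsFacet (linkComplex Δ σ) G ↔ ∃ i : Fin q, σ ⊆ F i ∧ G = F i \ σ) ∧
    IsShelling (linkComplex Δ σ)
      (fun j : Fin ((Finset.univ.filter (fun i : Fin q => σ ⊆ F i)).card) =>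
        F (((Finset.univ.filter (fun i : Fin q => σ ⊆ F i)).orderIsoOfFin rfl j) : Fin q) \ σ) := by
  refine ⟨fun G => ?_, hF.linkComplex hΔ (fun a b hab => ?_) fun i => ?_⟩
  · rw [isFacet_linkComplex_iff hΔ]
    simp only [hF.2.1]
    constructor
    · rintro ⟨_, ⟨i, rfl⟩, h⟩
      exact ⟨i, h⟩
    · rintro ⟨i, h⟩
      exact ⟨F i, ⟨i, rfl⟩, h⟩
  · exact ((Finset.univ.filter (fun i : Fin q => σ ⊆ F i)).orderIsoOfFin rfl).strictMono hab
  · constructor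
    · intro h
      obtain ⟨j, hj⟩ := ((Finset.univ.filter (fun i : Fin q => σ ⊆ F i)).orderIsoOfFin
        rfl).surjective ⟨i, by simpa using h⟩
      exact ⟨j, congrArg Subtype.val hj⟩
    · rintro ⟨j, rfl⟩
      exact (Finset.mem_filter.1
        ((Finset.univ.filter (fun i : Fin q => σ ⊆ F i)).orderIsoOfFin rfl j).2).2
end

section
/- Let 1 ≤ k < n, let Δ_{n,n−k} be the simplicial complex on [n] whose facets are all (n − k)-element subsets of [n], with its facets ordered lexicographically (comparing increasing lists of elements); this order is a shelling. For a facet F of Δ_{n,n−k}, let m ≥ 0 be the largest integer with {1, …, m} ⊆ F. Then the face G_F associated to F by this shelling equals {1, …, m}. -/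
variable {α : Type*}

/-- Given an enumeration `F` of the facets (a shelling order), `shellingG F i` is the face
`G_i`: the intersection, inside `F i`, of all walls (codimension-1 faces) of `F i` that lie
in the subcomplex generated by the earlier facets.  (For `i` with no such wall, e.g. the
first facet, this is `F i` itself, so `G_1 = F_1`.) -/
def shellingG [DecidableEq α] {q : ℕ} (F : Fin q → Finset α) (i : Fin q) : Finset α :=
  (F i).filter (fun x =>
    ∀ W ∈ (F i).powerset, W.card = (F i).card - 1 → (∃ j, j < i ∧ W ⊆ F j) → x ∈ W)

/-- The complex `Δ_{n,n-k}` on `[n] = {1,…,n}` whose facets are all `(n-k)`-subsets. -/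
def deltaNK (n k : ℕ) : Finset (Finset ℕ) :=
  (Finset.Icc 1 n).powerset.filter (fun G => G.card ≤ n - k)

/-- Inserting a smaller new entry gives a lexicographically smaller list. -/
theorem List.lex_orderedInsert_of_lt {β : Type*} [LinearOrder β] {a b : β} (hab : a < b) :
    ∀ l : List β, a ∉ l →
      List.Lex (· < ·) (l.orderedInsert (· ≤ ·) a) (l.orderedInsert (· ≤ ·) b)
  | [], _ => List.Lex.rel hab
  | c :: t, ha => by
    rw [List.mem_cons, not_or] at ha
    rcases lt_or_gt_of_ne ha.1 with hac | hca
    · rw [List.orderedInsert_cons_of_le _ _ hac.le, List.orderedInsert_cons]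
      split_ifs
      · exact List.Lex.rel hab
      · exact List.Lex.rel hac
    · rw [List.orderedInsert_of_not_le _ _ hca.not_ge,
        List.orderedInsert_of_not_le _ _ (hca.trans hab).not_ge]
      exact List.Lex.cons (List.lex_orderedInsert_of_lt hab t ha.2)

theorem Finset.sort_insert_eq_orderedInsert {β : Type*} [LinearOrder β] {a : β} {s : Finset β}
    (ha : a ∉ s) :
    (insert a s).sort (· ≤ ·) = (s.sort (· ≤ ·)).orderedInsert (· ≤ ·) a := by
  refine List.Perm.eq_of_pairwise' (Finset.pairwise_sort _ _)
    ((Finset.pairwise_sort s (· ≤ ·)).orderedInsert a _) ?_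
  refine List.Perm.trans ?_ (List.perm_orderedInsert _ _ _).symm
  rw [← Multiset.coe_eq_coe, ← Multiset.cons_coe, Finset.sort_eq, Finset.sort_eq,
    Finset.insert_val_of_notMem ha]

/-- Replacing an element of a finite set by a smaller new one decreases the set
lexicographically. -/
theorem Finset.lex_sort_insert_of_lt {β : Type*} [LinearOrder β] {a b : β} {s : Finset β}
    (hab : a < b) (ha : a ∉ s) (hb : b ∉ s) :
    List.Lex (· < ·) ((insert a s).sort (· ≤ ·)) ((insert b s).sort (· ≤ ·)) := by
  rw [Finset.sort_insert_eq_orderedInsert ha, Finset.sort_insert_eq_orderedInsert hb]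
  exact List.lex_orderedInsert_of_lt hab _ (by simpa using ha)

theorem isFacet_deltaNK_iff {n k : ℕ} {G : Finset ℕ} :
    IsFacet (deltaNK n k) G ↔ G ⊆ Finset.Icc 1 n ∧ G.card = n - k := by
  simp only [IsFacet, deltaNK, Finset.mem_filter, Finset.mem_powerset]
  constructor
  · rintro ⟨⟨hG, hcard⟩, hmax⟩
    refine ⟨hG, ?_⟩
    obtain ⟨H, hGH, hH, hHcard⟩ := Finset.exists_subsuperset_card_eq hG hcard (by simp)
    rw [← hmax H ⟨hH, hHcard.le⟩ hGH, hHcard]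
  · rintro ⟨hG, hcard⟩
    exact ⟨⟨hG, hcard.le⟩, fun H hH hGH =>
      (Finset.eq_of_subset_of_card_le hGH (hcard ▸ hH.2)).symm⟩

/-- in the lexicographic shelling of `Δ_{n,n-k}`, for a facet `F i`, if
`m` is the largest integer with `{1,…,m} ⊆ F i`, then the associated face `G_i`
equals `{1,…,m}`. -/
theorem statement5 (n k : ℕ) (hk1 : 1 ≤ k) (hkn : k < n)
    {q : ℕ} (F : Fin q → Finset ℕ) (hinj : Function.Injective F)
    (hsurj : ∀ G : Finset ℕ, IsFacet (deltaNK n k) G ↔ ∃ i, F i = G)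
    (hlex : ∀ i j : Fin q, i < j →
      List.Lex (· < ·) ((F i).sort (· ≤ ·)) ((F j).sort (· ≤ ·)))
    (i : Fin q) (m : ℕ)
    (hm : Finset.Icc 1 m ⊆ F i) (hm' : ¬ Finset.Icc 1 (m + 1) ⊆ F i) :
    shellingG F i = Finset.Icc 1 m := by
  have hfacet (j : Fin q) : F j ⊆ Finset.Icc 1 n ∧ (F j).card = n - k :=
    isFacet_deltaNK_iff.1 ((hsurj _).2 ⟨j, rfl⟩)
  have hpos : 0 < (F i).card := by have := (hfacet i).2; omega
  have hnotMem : m + 1 ∉ F i := fun h => hm' fun y hy => by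
    rw [Finset.mem_Icc] at hy
    rcases hy.2.eq_or_lt with rfl | hlt
    · exact h
    · exact hm (Finset.mem_Icc.2 ⟨hy.1, by omega⟩)
  ext x
  simp only [shellingG, Finset.mem_filter, Finset.mem_powerset]
  constructor
  · rintro ⟨hx, hwalls⟩
    have hxn := Finset.mem_Icc.1 ((hfacet i).1 hx)
    refine Finset.mem_Icc.2 ⟨hxn.1, ?_⟩
    by_contra! hmx
    have hlt : m + 1 < x := lt_of_le_of_ne hmx fun h => hnotMem (h ▸ hx)
    have hnew : m + 1 ∉ (F i).erase x := fun h => hnotMem (Finset.mem_of_mem_erase h)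
    obtain ⟨j, hj⟩ := (hsurj (insert (m + 1) ((F i).erase x))).1 <| isFacet_deltaNK_iff.2 <| by
      refine ⟨Finset.insert_subset (Finset.mem_Icc.2 ⟨by omega, by omega⟩)
        ((Finset.erase_subset _ _).trans (hfacet i).1), ?_⟩
      rw [Finset.card_insert_of_notMem hnew, Finset.card_erase_of_mem hx, ← (hfacet i).2]
      omega
    have hlexji : List.Lex (· < ·) ((F j).sort (· ≤ ·)) ((F i).sort (· ≤ ·)) := by
      have h := Finset.lex_sort_insert_of_lt hlt hnew (Finset.notMem_erase x _)
      rwa [Finset.insert_erase hx, ← hj] at h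
    have hji : j < i := by
      rcases lt_trichotomy j i with h | rfl | h
      · exact h
      · exact absurd hlexji (irrefl _)
      · exact absurd hlexji (asymm (hlex i j h))
    exact Finset.notMem_erase x (F i) <| hwalls _ (Finset.erase_subset _ _)
      (Finset.card_erase_of_mem hx) ⟨j, hji, hj ▸ Finset.subset_insert _ _⟩
  · refine fun hx => ⟨hm hx, ?_⟩
    rintro W hW hWcard ⟨j, hji, hWj⟩
    by_contra hxW
    have hFi : insert x W = F i := Finset.eq_of_subset_of_card_le
      (Finset.insert_subset (hm hx) hW) (by rw [Finset.card_insert_of_notMem hxW]; omega)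
    obtain ⟨y, hyj, hyW⟩ : ∃ y ∈ F j, y ∉ W := Finset.exists_mem_notMem_of_card_lt_card (by
      have := (hfacet i).2
      have := (hfacet j).2
      omega)
    have hFj : insert y W = F j := Finset.eq_of_subset_of_card_le
      (Finset.insert_subset hyj hWj) (by
        rw [Finset.card_insert_of_notMem hyW, (hfacet j).2, ← (hfacet i).2]
        omega)
    have hyi : y ∉ F i := by
      rw [← hFi, Finset.mem_insert, not_or]
      refine ⟨?_, hyW⟩
      rintro rfl
      exact hji.ne (hinj (hFj.symm.trans hFi))
    have hxy : x < y := by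
      by_contra! hyx
      exact hyi (hm (Finset.mem_Icc.2
        ⟨(Finset.mem_Icc.1 ((hfacet j).1 hyj)).1, hyx.trans (Finset.mem_Icc.1 hx).2⟩))
    have h := Finset.lex_sort_insert_of_lt hxy hxW hyW
    rw [hFi, hFj] at h
    exact asymm h (hlex j i hji)
end

section
/- Let 2 ≤ k ≤ n, let Δ_{n,n−k} be the simplicial complex on [n] whose facets are all (n − k)-element subsets of [n], with the lexicographic shelling of its facets, and let 1 ≤ p ≤ ⌊n/k⌋. Then the number of shelling-trapped decompositions of [n] over Δ_{n,n−k} having exactly p parts equals Σ_{0 = i_0 ≤ i_1 ≤ ⋯ ≤ i_p = n − pk} Π_{j=0}^{p−1} C(n − jk − i_j − 1, k − 1) · (j + 1)^{i_{j+1} − i_j}, where the sum is over all weakly increasing integer sequences 0 = i_0 ≤ i_1 ≤ ⋯ ≤ i_p = n − pk and C(·,·) denotes a binomial coefficient. -/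
variable {α : Type*}

/-- `(idx, T)` encodes a shelling-trapped decomposition of `σbar ⊆ V` over the complex with
shelling order `F`, with parts `T 0, …, T (p-1)` (listed in increasing order of the indices
`idx j` of the corresponding facets): the parts are pairwise disjoint with union `σbar`, and
`G_{idx j} ⊆ V - T j ⊆ F (idx j)` for every `j`. -/
def IsShellingTrappedDecomp [DecidableEq α] {q : ℕ} (F : Fin q → Finset α)
    (V σbar : Finset α) (p : ℕ) (idx : Fin p → Fin q) (T : Fin p → Finset α) : Prop :=
  StrictMono idx ∧
  (∀ j j' : Fin p, j ≠ j' → Disjoint (T j) (T j')) ∧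
  Finset.univ.biUnion T = σbar ∧
  ∀ j : Fin p, shellingG F (idx j) ⊆ V \ T j ∧ V \ T j ⊆ F (idx j)

/-- Ways of sorting the elements of `S` into `p` blocks, the first `m` of which already exist.
The label `some (j, b)` puts an element into block `j`, and `b` records whether the element
belongs to the core of that block. Every new block has a core of size `k`, and no element
precedes the core of its own or of an earlier new block. -/
def blockLabelings [LinearOrder α] (p k : ℕ) (S : Finset α) (m : ℕ) :
    Set (α → Option (Fin p × Bool)) :=
  {g | (∀ x, g x = none ↔ x ∉ S) ∧
    (∀ j : Fin p, (S.filter (fun x => g x = some (j, true))).card = if (j : ℕ) < m then 0 else k) ∧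
    ∀ x j b, g x = some (j, b) → ∀ i : Fin p, m ≤ (i : ℕ) → i ≤ j →
      ∃ y ≤ x, g y = some (i, true)}

/-- The number of block labelings of an `N`-element set with `m` old and `r` new blocks. -/
def blockLabelingCount (k : ℕ) : ℕ → ℕ → ℕ → ℕ
  | 0, N, m => m ^ N
  | r + 1, N, m => ∑ i ∈ Finset.range N,
      m ^ i * (N - 1 - i).choose (k - 1) * blockLabelingCount k r (N - i - k) (m + 1)

theorem blockLabelingCount_succ (k r N m : ℕ) :
    blockLabelingCount k (r + 1) (N + 1) m =
      m * blockLabelingCount k (r + 1) N m +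
        N.choose (k - 1) * blockLabelingCount k r (N + 1 - k) (m + 1) := by
  simp only [blockLabelingCount]
  rw [Finset.sum_range_succ', Finset.mul_sum]
  simp only [pow_zero, one_mul, Nat.sub_zero, Nat.add_sub_cancel, add_left_inj]
  refine Finset.sum_congr rfl fun i _ => ?_
  rw [show N - (i + 1) = N - 1 - i by omega, show N + 1 - (i + 1) - k = N - i - k by omega]
  ring

theorem blockLabelingCount_eq_zero {k r N : ℕ} (m : ℕ) (hk : 1 ≤ k) (h : N < r * k) :
    blockLabelingCount k r N m = 0 := by
  induction r generalizing N m with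
  | zero => simp at h
  | succ r ih =>
    refine Finset.sum_eq_zero fun i hi => ?_
    rw [Finset.mem_range] at hi
    rw [add_mul, one_mul] at h
    by_cases hlt : N - 1 - i < k - 1
    · simp [Nat.choose_eq_zero_of_lt hlt]
    · rw [ih (m + 1) (by omega), mul_zero]

section BlockLabelings

variable [LinearOrder α] {p k m : ℕ} {S : Finset α} {a : α}

theorem finite_blockLabelings (p k : ℕ) (S : Finset α) (m : ℕ) :
    Finite (blockLabelings p k S m) := by
  refine Finite.of_injective
    (fun g => (fun x : S => g.1 x : S → Option (Fin p × Bool))) fun g g' h => ?_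
  ext1
  funext x
  by_cases hx : x ∈ S
  · exact congrFun h ⟨x, hx⟩
  · rw [(g.2.1 x).2 hx, (g'.2.1 x).2 hx]

/-- Put the least element `a` into an old block. -/
theorem card_blockLabelings_old (ha : a ∈ S) (hm : m ≤ p) :
    Nat.card {g : blockLabelings p k S m // ∃ j b, g.1 a = some (j, b) ∧ (j : ℕ) < m} =
      m * Nat.card (blockLabelings p k (S.erase a) m) := by
  classical
  rw [← Nat.card_fin m, ← Nat.card_prod, Nat.card_fin]
  symm
  have mem : ∀ (j : Fin m) (g : blockLabelings p k (S.erase a) m),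
      Function.update g.1 a (some (Fin.castLE hm j, false)) ∈ blockLabelings p k S m := by
    rintro j ⟨g, h1, h2, h3⟩
    have hga : g a = none := by simp [h1]
    refine ⟨fun x => ?_, fun i => ?_, fun x i b hx i' hi' hle => ?_⟩
    · by_cases hx : x = a
      · subst hx; simp [ha]
      · simp [hx, h1]
    · rw [← h2 i]
      congr 1
      ext x
      by_cases hx : x = a
      · subst hx; simp
      · simp [hx]
    · by_cases hxa : x = a
      · subst hxa
        simp at hx
        have := j.2
        have h4 : (i' : ℕ) ≤ i := hle
        rw [← hx.1] at h4
        simp at h4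
        omega
      · simp only [Function.update_of_ne hxa] at hx
        obtain ⟨y, hy, hgy⟩ := h3 x i b hx i' hi' hle
        refine ⟨y, hy, ?_⟩
        have hya : y ≠ a := by
          rintro rfl
          simp [hga] at hgy
        simpa [hya] using hgy
  refine Nat.card_eq_of_bijective
    (fun x : Fin m × blockLabelings p k (S.erase a) m =>
      (⟨⟨_, mem x.1 x.2⟩, Fin.castLE hm x.1, false, by simp, by simp⟩ :
        {g : blockLabelings p k S m // ∃ j b, g.1 a = some (j, b) ∧ (j : ℕ) < m})) ⟨?_, ?_⟩
  · rintro ⟨j, g, hg⟩ ⟨j', g', hg'⟩ h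
    simp only [Subtype.mk.injEq] at h
    have hj := congrFun h a
    simp at hj
    subst hj
    simp only [Prod.mk.injEq, Subtype.mk.injEq, true_and]
    funext x
    by_cases hx : x = a
    · subst hx
      rw [(hg.1 x).2 (by simp), (hg'.1 x).2 (by simp)]
    · simpa [hx] using congrFun h x
  · rintro ⟨⟨g, h1, h2, h3⟩, j, b, hga, hj⟩
    dsimp only at hga
    have hb : b = false := by
      cases b
      · rfl
      · have := h2 j
        rw [if_pos hj, Finset.card_eq_zero] at this
        exact absurd (Finset.mem_filter.2 ⟨ha, hga⟩) (this ▸ Finset.notMem_empty a)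
    subst hb
    refine ⟨⟨⟨j, hj⟩, Function.update g a none, fun x => ?_, fun i => ?_,
      fun x i b hx i' hi' hle => ?_⟩, ?_⟩
    · by_cases hx : x = a
      · subst hx; simp
      · simp [hx, h1]
    · rw [← h2 i]
      congr 1
      ext x
      by_cases hx : x = a
      · subst hx; simp [hga]
      · simp [hx]
    · have hxa : x ≠ a := by rintro rfl; simp at hx
      rw [Function.update_of_ne hxa] at hx
      obtain ⟨y, hy, hgy⟩ := h3 x i b hx i' hi' hle
      refine ⟨y, hy, ?_⟩
      rw [Function.update_of_ne, hgy]
      rintro rfl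
      simp [hga] at hgy
    · refine Subtype.ext (Subtype.ext (funext fun x => ?_))
      by_cases hx : x = a
      · subst hx; simp [hga]
      · simp [hx]

theorem blockLabelings_min_eq (ha : a ∈ S) (hmin : ∀ x ∈ S, a ≤ x)
    {g : α → Option (Fin p × Bool)} (hg : g ∈ blockLabelings p k S m)
    (hold : ¬ ∃ j b, g a = some (j, b) ∧ (j : ℕ) < m) :
    ∃ hm : m < p, g a = some (⟨m, hm⟩, true) := by
  obtain ⟨h1, -, h3⟩ := hg
  cases hga : g a with
  | none => exact absurd ha ((h1 a).1 hga)
  | some jb =>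
    obtain ⟨j, b⟩ := jb
    have hj : m ≤ (j : ℕ) := by
      by_contra h
      exact hold ⟨j, b, hga, by omega⟩
    have hm : m < p := hj.trans_lt j.2
    obtain ⟨y, hy, hgy⟩ := h3 a j b hga ⟨m, hm⟩ le_rfl hj
    have hyS : y ∈ S := by
      by_contra h
      simp [(h1 y).2 h] at hgy
    obtain rfl := le_antisymm hy (hmin y hyS)
    exact ⟨hm, hga ▸ hgy⟩

/-- Let the least element `a` start a new block, whose core is `insert a C`. -/
theorem card_blockLabelings_new (hk : 1 ≤ k) (ha : a ∈ S) (hmin : ∀ x ∈ S, a ≤ x) (hm : m < p) :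
    Nat.card {g : blockLabelings p k S m // ¬ ∃ j b, g.1 a = some (j, b) ∧ (j : ℕ) < m} =
      ∑ C ∈ (S.erase a).powersetCard (k - 1),
        Nat.card (blockLabelings p k (S \ insert a C) (m + 1)) := by
  classical
  have := finite_blockLabelings p k (α := α)
  rw [← Finset.sum_coe_sort, ← Nat.card_sigma]
  symm
  have sub : ∀ C : (S.erase a).powersetCard (k - 1),
      insert a C.1 ⊆ S ∧ (insert a C.1).card = k := by
    rintro ⟨C, hC⟩
    rw [Finset.mem_powersetCard] at hC
    refine ⟨Finset.insert_subset ha (hC.1.trans (Finset.erase_subset _ _)), ?_⟩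
    rw [Finset.card_insert_of_notMem fun h => by simpa using hC.1 h, hC.2]
    omega
  have mem : ∀ (C : (S.erase a).powersetCard (k - 1))
      (g : blockLabelings p k (S \ insert a C.1) (m + 1)),
      (fun x => if x ∈ insert a C.1 then some (⟨m, hm⟩, true) else g.1 x) ∈
        blockLabelings p k S m := by
    rintro C ⟨g, h1, h2, h3⟩
    obtain ⟨hCS, hCk⟩ := sub C
    generalize hD : insert a C.1 = D at *
    have haD : a ∈ D := hD ▸ Finset.mem_insert_self _ _
    have hgD : ∀ x ∈ D, g x = none := fun x hx => by simp [h1, hx]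
    dsimp only
    refine ⟨fun x => ?_, fun i => ?_, fun x i b hx i' hi' hle => ?_⟩
    · by_cases hx : x ∈ D
      · simp [hx, hCS hx]
      · simp [hx, h1]
    · by_cases hi : i = ⟨m, hm⟩
      · subst hi
        rw [if_neg (by simp), ← hCk]
        congr 1
        ext x
        by_cases hx : x ∈ D
        · simp [hx, hCS hx]
        · simp only [Finset.mem_filter, hx, if_false, iff_false, not_and]
          intro hxS hgx
          have := h2 ⟨m, hm⟩
          rw [if_pos (by simp), Finset.card_eq_zero] at this
          exact Finset.notMem_empty x (this ▸ Finset.mem_filter.2 ⟨by simp [hx, hxS], hgx⟩)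
      · have hne : (i : ℕ) ≠ m := fun h => hi (Fin.ext h)
        have := h2 i
        simp only [show ((i : ℕ) < m + 1 ↔ (i : ℕ) < m) by omega] at this
        rw [← this]
        congr 1
        ext x
        by_cases hx : x ∈ D
        · simp [hx, Ne.symm hi]
        · simp [hx]
    · dsimp only at hx ⊢
      by_cases hi : i' = ⟨m, hm⟩
      · subst hi
        refine ⟨a, hmin x ?_, by simp [haD]⟩
        by_cases hxD : x ∈ D
        · exact hCS hxD
        · rw [if_neg hxD] at hx
          by_contra hxS
          simp [(h1 x).2 (by simp [hxS])] at hx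
      · have hne : (i' : ℕ) ≠ m := fun h => hi (Fin.ext h)
        have hxD : x ∉ D := by
          intro hxD
          simp only [hxD, if_true, Option.some.injEq, Prod.mk.injEq] at hx
          have h4 : (i' : ℕ) ≤ i := hle
          rw [← hx.1] at h4
          simp at h4
          omega
        rw [if_neg hxD] at hx
        obtain ⟨y, hy, hgy⟩ := h3 x i b hx i' (by omega) hle
        refine ⟨y, hy, ?_⟩
        rw [if_neg, hgy]
        intro hyD
        simp [hgD y hyD] at hgy
  refine Nat.card_eq_of_bijective
    (fun x : Σ C : (S.erase a).powersetCard (k - 1),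
        blockLabelings p k (S \ insert a C.1) (m + 1) =>
      (⟨⟨_, mem x.1 x.2⟩, by simp +contextual [eq_comm]⟩ :
        {g : blockLabelings p k S m // ¬ ∃ j b, g.1 a = some (j, b) ∧ (j : ℕ) < m})) ⟨?_, ?_⟩
  · rintro ⟨C, g, hg⟩ ⟨C', g', hg'⟩ h
    simp only [Subtype.mk.injEq] at h
    have key : ∀ (C C' : (S.erase a).powersetCard (k - 1)) (g g' : α → Option (Fin p × Bool)),
        g' ∈ blockLabelings p k (S \ insert a C'.1) (m + 1) →
        ((fun x => if x ∈ insert a C.1 then some (⟨m, hm⟩, true) else g x) =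
          fun x => if x ∈ insert a C'.1 then some (⟨m, hm⟩, true) else g' x) → C.1 ⊆ C'.1 := by
      intro C C' g g' hg' h x hx
      have hxa : x ∈ S ∧ x ≠ a := by
        have := (Finset.mem_powersetCard.1 C.2).1 hx
        rw [Finset.mem_erase] at this
        exact this.symm
      by_contra hx'
      have := congrFun h x
      simp only [Finset.mem_insert, hx, hxa.2, hx', or_true, if_true, or_false, if_false] at this
      have h2 := hg'.2.1 ⟨m, hm⟩
      rw [if_pos (by simp), Finset.card_eq_zero] at h2
      exact Finset.notMem_empty x
        (h2 ▸ Finset.mem_filter.2 ⟨by simp [hx', hxa], this.symm⟩)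
    have hC : C = C' :=
      Subtype.ext (Finset.Subset.antisymm (key C C' g g' hg' h) (key C' C g' g hg h.symm))
    subst hC
    simp only [Sigma.mk.injEq, heq_eq_eq, Subtype.mk.injEq, true_and]
    funext x
    by_cases hx : x ∈ insert a C.1
    · rw [(hg.1 x).2 (by simp [hx]), (hg'.1 x).2 (by simp [hx])]
    · simpa only [hx, if_false] using congrFun h x
  · rintro ⟨⟨g, hg⟩, hold⟩
    obtain ⟨_, hga⟩ := blockLabelings_min_eq ha hmin hg hold
    obtain ⟨h1, h2, h3⟩ := hg
    set D := S.filter (fun x => g x = some (⟨m, hm⟩, true)) with hDdef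
    have haD : a ∈ D := by simp [hDdef, ha, hga]
    have hDk : D.card = k := by rw [h2]; simp
    have hins : insert a (D.erase a) = D := Finset.insert_erase haD
    have hD : ∀ x, x ∈ D ↔ g x = some (⟨m, hm⟩, true) := by
      intro x
      simp only [hDdef, Finset.mem_filter, and_iff_right_iff_imp]
      intro h
      by_contra hx
      simp [(h1 x).2 hx] at h
    have hC : D.erase a ∈ (S.erase a).powersetCard (k - 1) := by
      rw [Finset.mem_powersetCard, Finset.card_erase_of_mem haD, hDk]
      exact ⟨Finset.erase_subset_erase _ (Finset.filter_subset _ _), rfl⟩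
    refine ⟨⟨⟨D.erase a, hC⟩, fun x => if x ∈ D then none else g x, ?_⟩, ?_⟩
    · simp only [hins]
      refine ⟨fun x => ?_, fun i => ?_, fun x i b hx i' hi' hle => ?_⟩
      · by_cases hx : x ∈ D
        · simp [hx]
        · simp [hx, h1]
      · by_cases hi : i = ⟨m, hm⟩
        · subst hi
          rw [if_pos (by simp), Finset.card_eq_zero, Finset.filter_eq_empty_iff]
          intro x hx h
          rw [Finset.mem_sdiff] at hx
          dsimp only at h
          rw [if_neg hx.2] at h
          exact hx.2 ((hD x).2 h)
        · have hne : (i : ℕ) ≠ m := fun h => hi (Fin.ext h)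
          have := h2 i
          simp only [show ((i : ℕ) < m ↔ (i : ℕ) < m + 1) by omega] at this
          rw [← this]
          congr 1
          ext x
          by_cases hx : x ∈ D
          · simp [hx, (hD x).1 hx, Ne.symm hi]
          · simp [hx]
      · dsimp only at hx ⊢
        have hxD : x ∉ D := fun h => by simp [h] at hx
        rw [if_neg hxD] at hx
        obtain ⟨y, hy, hgy⟩ := h3 x i b hx i' (by omega) hle
        refine ⟨y, hy, ?_⟩
        rw [if_neg, hgy]
        rw [hD, hgy]
        simp only [Option.some.injEq, Prod.mk.injEq, and_true]
        rintro rfl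
        simp at hi'
    · refine Subtype.ext (Subtype.ext (funext fun x => ?_))
      simp only [hins]
      by_cases hx : x ∈ D
      · simp [hx, (hD x).1 hx]
      · simp [hx]

theorem card_blockLabelings (hk : 1 ≤ k) (S : Finset α) {m r : ℕ} (hp : m + r = p) :
    Nat.card (blockLabelings p k S m) = blockLabelingCount k r S.card m := by
  classical
  induction hN : S.card using Nat.strong_induction_on generalizing S m r with
  | _ N ih =>
  have := finite_blockLabelings p k (α := α)
  obtain rfl | hne := S.eq_empty_or_nonempty
  · obtain rfl : N = 0 := by simpa using hN.symm
    cases r with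
    | zero =>
      rw [blockLabelingCount, pow_zero, Nat.card_eq_one_iff_unique]
      refine ⟨⟨fun g g' => Subtype.ext (funext fun x => ?_)⟩, ⟨fun _ => none, ?_, ?_, ?_⟩⟩
      · rw [(g.2.1 x).2 (by simp), (g'.2.1 x).2 (by simp)]
      · simp
      · intro j
        have := j.2
        simp
        omega
      · simp
    | succ r =>
      rw [blockLabelingCount, Finset.range_zero, Finset.sum_empty, Nat.card_eq_zero]
      refine Or.inl ⟨fun g => ?_⟩
      have := g.2.2.1 ⟨m, by omega⟩
      simp at this
      omega
  · set a := S.min' hne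
    have ha : a ∈ S := S.min'_mem hne
    have hmin : ∀ x ∈ S, a ≤ x := fun x hx => S.min'_le x hx
    have hcard : (S.erase a).card = N - 1 := by rw [Finset.card_erase_of_mem ha, hN]
    have hpos : 0 < N := hN ▸ hne.card_pos
    rw [← Nat.card_congr (Equiv.sumCompl fun g : blockLabelings p k S m =>
      ∃ j b, g.1 a = some (j, b) ∧ (j : ℕ) < m), Nat.card_sum,
      card_blockLabelings_old ha (by omega), ih (N - 1) (by omega) _ hp hcard]
    obtain ⟨N, rfl⟩ : ∃ N', N = N' + 1 := ⟨N - 1, by omega⟩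
    cases r with
    | zero =>
      have : IsEmpty {g : blockLabelings p k S m // ¬ ∃ j b, g.1 a = some (j, b) ∧ (j : ℕ) < m} :=
        ⟨fun g => by
          obtain ⟨hm, -⟩ := blockLabelings_min_eq ha hmin g.1.2 g.2
          omega⟩
      rw [Nat.card_of_isEmpty]
      simp [blockLabelingCount, pow_succ']
    | succ r =>
      rw [card_blockLabelings_new hk ha hmin (by omega), blockLabelingCount_succ]
      congr 1
      rw [Finset.sum_congr rfl (g := fun _ => blockLabelingCount k r (N + 1 - k) (m + 1)),
        Finset.sum_const, Finset.card_powersetCard, hcard, smul_eq_mul, Nat.add_sub_cancel]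
      intro C hC
      rw [Finset.mem_powersetCard] at hC
      have haC : a ∉ C := fun h => by simpa using hC.1 h
      refine ih (N + 1 - k) (by omega) _ (by omega) ?_
      rw [Finset.card_sdiff_of_subset
        (Finset.insert_subset ha (hC.1.trans (Finset.erase_subset _ _))),
        Finset.card_insert_of_notMem haC, hN]
      omega

end BlockLabelings

theorem List.lex_of_mem_of_notMem {l₁ l₂ : List ℕ} (h₁ : l₁.Pairwise (· < ·))
    (h₂ : l₂.Pairwise (· < ·)) (hlen : l₁.length = l₂.length) {y : ℕ} (hy₁ : y ∈ l₁)
    (hy₂ : y ∉ l₂) (h : ∀ z < y, z ∈ l₁ ↔ z ∈ l₂) : List.Lex (· < ·) l₁ l₂ := by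
  induction l₁ generalizing l₂ with
  | nil => simp at hy₁
  | cons a l₁ ih =>
    cases l₂ with
    | nil => simp at hlen
    | cons b l₂ =>
      rw [List.pairwise_cons] at h₁ h₂
      simp only [List.mem_cons, not_or] at hy₁ hy₂ h
      have hay : a ≤ y := by
        rcases hy₁ with rfl | hy
        · exact le_rfl
        · exact (h₁.1 y hy).le
      rcases lt_trichotomy a b with hab | rfl | hab
      · exact List.Lex.rel hab
      · refine List.Lex.cons (ih h₁.2 h₂.2 (by simpa using hlen) (by tauto) hy₂.2 ?_)
        intro z hz
        have := h z hz
        constructor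
        · intro hz₁
          have := h₁.1 z hz₁
          grind
        · intro hz₂
          have := h₂.1 z hz₂
          grind
      · exfalso
        rcases (h b (by omega)).2 (Or.inl rfl) with rfl | hb
        · omega
        · have := h₁.1 b hb
          omega

section LexShelling

variable {n k q : ℕ} {F : Fin q → Finset ℕ}

theorem lt_of_lex_of_mem_sdiff (hcard : ∀ i, (F i).card = n - k)
    (hlex : ∀ i j : Fin q, i < j →
      List.Lex (· < ·) ((F i).sort (· ≤ ·)) ((F j).sort (· ≤ ·)))
    {i j : Fin q} {y : ℕ} (hi : y ∈ F i) (hj : y ∉ F j) (h : ∀ z < y, z ∈ F i ↔ z ∈ F j) :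
    i < j := by
  by_contra hij
  rcases (not_lt.1 hij).eq_or_lt with rfl | hlt
  · exact hj hi
  · have h1 := hlex j i hlt
    have h2 : List.Lex (· < ·) ((F i).sort (· ≤ ·)) ((F j).sort (· ≤ ·)) :=
      List.lex_of_mem_of_notMem (y := y) (Finset.sortedLT_sort _).pairwise
        (Finset.sortedLT_sort _).pairwise (by simp [hcard]) (by simpa) (by simpa) (by simpa)
    exact asymm_of (List.Lex (· < ·)) h1 h2

/-- The complement of the earlier of two facets with disjoint complements has the larger
minimum. -/
theorem exists_lt_of_disjoint_compl (hsub : ∀ i, F i ⊆ Finset.Icc 1 n)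
    (hcard : ∀ i, (F i).card = n - k)
    (hlex : ∀ i j : Fin q, i < j →
      List.Lex (· < ·) ((F i).sort (· ≤ ·)) ((F j).sort (· ≤ ·)))
    {i j : Fin q} (hij : i < j)
    (hd : Disjoint (Finset.Icc 1 n \ F i) (Finset.Icc 1 n \ F j))
    {x : ℕ} (hx : x ∈ Finset.Icc 1 n \ F i) : ∃ y ∈ Finset.Icc 1 n \ F j, y < x := by
  by_contra! hno
  set x₀ := (Finset.Icc 1 n \ F i).min' ⟨x, hx⟩ with hx₀
  have hmem : x₀ ∈ Finset.Icc 1 n \ F i := Finset.min'_mem _ _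
  have hle : x₀ ≤ x := Finset.min'_le _ _ hx
  have hmin : ∀ z ∈ Finset.Icc 1 n \ F i, x₀ ≤ z := fun z hz => Finset.min'_le _ _ hz
  have hnot := Finset.disjoint_left.1 hd hmem
  rw [Finset.mem_sdiff] at hmem
  have hxj : x₀ ∈ F j := by
    by_contra h
    exact hnot (Finset.mem_sdiff.2 ⟨hmem.1, h⟩)
  refine absurd (lt_of_lex_of_mem_sdiff hcard hlex hxj hmem.2 fun z hz => ?_) hij.asymm
  constructor
  · intro hzj
    by_contra hzi
    exact absurd (hmin z (Finset.mem_sdiff.2 ⟨hsub j hzj, hzi⟩)) (by omega)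
  · intro hzi
    by_contra hzj
    exact absurd (hno z (Finset.mem_sdiff.2 ⟨hsub i hzi, hzj⟩)) (by omega)

theorem lt_of_disjoint_compl (hsub : ∀ i, F i ⊆ Finset.Icc 1 n)
    (hcard : ∀ i, (F i).card = n - k)
    (hlex : ∀ i j : Fin q, i < j →
      List.Lex (· < ·) ((F i).sort (· ≤ ·)) ((F j).sort (· ≤ ·)))
    {i j : Fin q} (hd : Disjoint (Finset.Icc 1 n \ F i) (Finset.Icc 1 n \ F j))
    (hne : (Finset.Icc 1 n \ F j).Nonempty)
    (h : ∀ x ∈ Finset.Icc 1 n \ F i, ∃ y ∈ Finset.Icc 1 n \ F j, y < x) : i < j := by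
  rcases lt_trichotomy i j with hij | rfl | hij
  · exact hij
  · rw [disjoint_self, Finset.bot_eq_empty] at hd
    simp [hd] at hne
  · exfalso
    obtain ⟨y, hy, hlt⟩ := exists_lt_of_disjoint_compl hsub hcard hlex hij hd.symm
      ((Finset.Icc 1 n \ F j).min'_mem hne)
    obtain ⟨z, hz, hzy⟩ := h y hy
    exact absurd ((Finset.Icc 1 n \ F j).min'_le z hz) (by omega)

theorem mem_shellingG_iff (hfacet : ∀ G : Finset ℕ, (∃ i, F i = G) ↔
      G ⊆ Finset.Icc 1 n ∧ G.card = n - k)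
    (hlex : ∀ i j : Fin q, i < j →
      List.Lex (· < ·) ((F i).sort (· ≤ ·)) ((F j).sort (· ≤ ·)))
    {i : Fin q} {x : ℕ} :
    x ∈ shellingG F i ↔ x ∈ F i ∧ ∀ y ∈ Finset.Icc 1 n \ F i, x < y := by
  have hsub : ∀ i, F i ⊆ Finset.Icc 1 n := fun i => ((hfacet _).1 ⟨i, rfl⟩).1
  have hcard : ∀ i, (F i).card = n - k := fun i => ((hfacet _).1 ⟨i, rfl⟩).2
  simp only [shellingG, Finset.mem_filter, Finset.mem_powerset, and_congr_right_iff]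
  intro hx
  have hpos : 0 < (F i).card := Finset.card_pos.2 ⟨x, hx⟩
  constructor
  · intro h y hy
    rw [Finset.mem_sdiff] at hy
    by_contra hxy
    have hyx : y < x := lt_of_le_of_ne (not_lt.1 hxy) fun h => hy.2 (h ▸ hx)
    have hy' : y ∉ (F i).erase x := fun h => hy.2 (Finset.mem_of_mem_erase h)
    obtain ⟨j, hj⟩ := (hfacet (insert y ((F i).erase x))).2
      ⟨Finset.insert_subset hy.1 ((Finset.erase_subset _ _).trans (hsub i)), by
        rw [Finset.card_insert_of_notMem hy', Finset.card_erase_of_mem hx, ← hcard i]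
        omega⟩
    refine Finset.notMem_erase x (F i) (h _ (Finset.erase_subset _ _)
      (Finset.card_erase_of_mem hx) ⟨j, ?_, hj ▸ Finset.subset_insert _ _⟩)
    refine lt_of_lex_of_mem_sdiff hcard hlex (y := y) (by simp [hj]) hy.2 fun z hz => ?_
    rw [hj, Finset.mem_insert, Finset.mem_erase]
    constructor
    · rintro (rfl | h)
      · omega
      · exact h.2
    · exact fun h => Or.inr ⟨by omega, h⟩
  · rintro h W hW hWc ⟨j, hji, hWj⟩
    by_contra hxW
    have hWe : W = (F i).erase x := by
      refine Finset.eq_of_subset_of_card_le (fun z hz => Finset.mem_erase.2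
        ⟨fun h => hxW (h ▸ hz), hW hz⟩) ?_
      rw [Finset.card_erase_of_mem hx, hWc]
    have hxj : x ∉ F j := by
      intro hxj
      have : F i ⊆ F j := by
        intro z hz
        by_cases hzx : z = x
        · exact hzx ▸ hxj
        · exact hWj (hWe ▸ Finset.mem_erase.2 ⟨hzx, hz⟩)
      have heq := Finset.eq_of_subset_of_card_le this (by rw [hcard, hcard])
      have h1 := hlex j i hji
      rw [heq] at h1
      exact irrefl_of (List.Lex (· < ·)) _ h1
    refine absurd (lt_of_lex_of_mem_sdiff hcard hlex hx hxj fun z hz => ?_) hji.asymm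
    constructor
    · intro hz'
      exact hWj (hWe ▸ Finset.mem_erase.2 ⟨by omega, hz'⟩)
    · intro hz'
      by_contra hzi
      exact absurd (h z (Finset.mem_sdiff.2 ⟨hsub j hz', hzi⟩)) (by omega)

theorem shellingG_subset_sdiff_iff (hfacet : ∀ G : Finset ℕ, (∃ i, F i = G) ↔
      G ⊆ Finset.Icc 1 n ∧ G.card = n - k)
    (hlex : ∀ i j : Fin q, i < j →
      List.Lex (· < ·) ((F i).sort (· ≤ ·)) ((F j).sort (· ≤ ·)))
    {i : Fin q} {T : Finset ℕ} (hT : T ⊆ Finset.Icc 1 n) :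
    (shellingG F i ⊆ Finset.Icc 1 n \ T ∧ Finset.Icc 1 n \ T ⊆ F i) ↔
      Finset.Icc 1 n \ F i ⊆ T ∧ ∀ x ∈ T, ∃ y ∈ Finset.Icc 1 n \ F i, y ≤ x := by
  have hsub : F i ⊆ Finset.Icc 1 n := ((hfacet _).1 ⟨i, rfl⟩).1
  rw [and_comm, sdiff_le_comm, and_congr_right_iff]
  intro hC
  constructor
  · intro h x hx
    by_contra! hno
    by_cases hxF : x ∈ F i
    · exact (Finset.mem_sdiff.1 (h ((mem_shellingG_iff hfacet hlex).2 ⟨hxF, hno⟩))).2 hx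
    · exact lt_irrefl _ (hno x (Finset.mem_sdiff.2 ⟨hT hx, hxF⟩))
  · intro h x hx
    rw [mem_shellingG_iff hfacet hlex] at hx
    refine Finset.mem_sdiff.2 ⟨hsub hx.1, fun hxT => ?_⟩
    obtain ⟨y, hy, hyx⟩ := h x hxT
    exact absurd (hx.2 y hy) (by omega)

end LexShelling

/-- The sum of `∏ j, w (m + j) (s j) (s (j + 1))` over all weakly increasing sequences
`a = s 0 ≤ ⋯ ≤ s r = M`. -/
def chainSum (n M : ℕ) (w : ℕ → ℕ → ℕ → ℕ) (r m a : ℕ) : ℕ :=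
  ∑ s ∈ Finset.univ.filter (fun s : Fin (r + 1) → Fin (n + 1) =>
      (∀ j j' : Fin (r + 1), j ≤ j' → (s j : ℕ) ≤ (s j' : ℕ)) ∧
      (s 0 : ℕ) = a ∧ (s (Fin.last r) : ℕ) = M),
    ∏ j : Fin r, w (m + j) (s j.castSucc) (s j.succ)

theorem chainSum_zero {n M : ℕ} (w : ℕ → ℕ → ℕ → ℕ) (hM : M ≤ n) (m a : ℕ) :
    chainSum n M w 0 m a = if a = M then 1 else 0 := by
  simp only [chainSum, Finset.univ_eq_empty, Finset.prod_empty, Finset.sum_const, smul_eq_mul,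
    mul_one]
  split_ifs with h
  · subst h
    rw [Finset.card_eq_one]
    refine ⟨fun _ => ⟨a, by omega⟩, ?_⟩
    ext s
    simp only [Finset.mem_filter, Finset.mem_univ, true_and, Finset.mem_singleton]
    constructor
    · rintro ⟨-, h, -⟩
      funext j
      rw [Fin.eq_zero j]
      exact Fin.ext h
    · rintro rfl
      simp
  · rw [Finset.card_eq_zero, Finset.filter_eq_empty_iff]
    rintro s - ⟨-, h0, h1⟩
    exact h (h0.symm.trans h1)

theorem chainSum_succ {n M a : ℕ} (w : ℕ → ℕ → ℕ → ℕ) (hM : M ≤ n) (r m : ℕ) (ha : a ≤ M) :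
    chainSum n M w (r + 1) m a =
      ∑ b ∈ Finset.Ico a (M + 1), w m a b * chainSum n M w r (m + 1) b := by
  simp only [chainSum, Finset.mul_sum]
  rw [Finset.sum_sigma']
  refine Finset.sum_bij' (fun s _ => ⟨(s 1 : ℕ), Fin.tail s⟩)
    (fun x _ => Fin.cons ⟨a, by omega⟩ x.2) ?_ ?_ ?_ ?_ ?_
  · intro s hs
    simp only [Finset.mem_filter, Finset.mem_univ, true_and] at hs
    obtain ⟨hmono, h0, h1⟩ := hs
    simp only [Finset.mem_sigma, Finset.mem_Ico, Finset.mem_filter, Finset.mem_univ, true_and,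
      Fin.tail, Fin.succ_last, h1, and_true]
    refine ⟨⟨h0 ▸ hmono 0 1 (Fin.zero_le _), ?_⟩, fun j j' hj => hmono _ _ (by simpa), rfl⟩
    have := hmono 1 (Fin.last _) (Fin.le_last _)
    omega
  · rintro ⟨b, t⟩ ht
    simp only [Finset.mem_sigma, Finset.mem_Ico, Finset.mem_filter, Finset.mem_univ,
      true_and] at ht
    obtain ⟨hb, hmono, h0, h1⟩ := ht
    simp only [Finset.mem_filter, Finset.mem_univ, true_and]
    refine ⟨fun j j' => ?_, by simp, ?_⟩
    · refine Fin.cases ?_ (fun i => ?_) j <;> refine Fin.cases ?_ (fun i' => ?_) j'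
      · simp
      · intro _
        have := hmono 0 i' (Fin.zero_le _)
        simp only [Fin.cons_zero, Fin.cons_succ]
        omega
      · intro h
        simp at h
      · intro h
        simpa using hmono i i' (by simpa using h)
    · rw [← Fin.succ_last, Fin.cons_succ]
      exact h1
  · intro s hs
    simp only [Finset.mem_filter, Finset.mem_univ, true_and] at hs
    refine Eq.trans ?_ (Fin.cons_self_tail s)
    congr 1
    exact Fin.ext hs.2.1.symm
  · rintro ⟨b, t⟩ ht
    simp only [Finset.mem_sigma, Finset.mem_filter] at ht
    simp only [Fin.tail_cons, Sigma.mk.injEq, heq_eq_eq, and_true]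
    exact ht.2.2.2.1
  · intro s hs
    simp only [Finset.mem_filter, Finset.mem_univ, true_and] at hs
    rw [Fin.prod_univ_succ]
    simp only [Fin.val_zero, add_zero, Fin.castSucc_zero, hs.2.1, Fin.succ_zero_eq_one, Fin.tail,
      Fin.val_succ, Fin.succ_castSucc, add_assoc, add_comm 1]

theorem chainSum_eq_blockLabelingCount {n k : ℕ} (hk : 1 ≤ k) (r m a : ℕ)
    (hn : (m + r + 1) * k ≤ n) (ha : a ≤ n - (m + r + 1) * k) :
    chainSum n (n - (m + r + 1) * k)
        (fun j a b => (n - j * k - a - 1).choose (k - 1) * (j + 1) ^ (b - a)) (r + 1) m a =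
      (n - m * k - a - 1).choose (k - 1) * blockLabelingCount k r (n - m * k - a - k) (m + 1) := by
  induction r generalizing m a with
  | zero =>
    rw [chainSum_succ _ (Nat.sub_le _ _) _ _ ha]
    simp only [chainSum_zero _ (Nat.sub_le _ _), mul_ite, mul_one, mul_zero]
    rw [Finset.sum_ite_eq', if_pos (Finset.mem_Ico.2 ⟨ha, Nat.lt_succ_self _⟩),
      blockLabelingCount]
    congr 2
    rw [add_zero, add_mul, one_mul] at hn ⊢
    omega
  | succ r ih =>
    rw [chainSum_succ _ (Nat.sub_le _ _) _ _ ha, blockLabelingCount, Finset.mul_sum,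
      Finset.sum_Ico_eq_sum_range]
    have e : (m + (r + 1) + 1) * k = m * k + r * k + k + k := by ring
    have e' : (m + 1 + r + 1) * k = m * k + r * k + k + k := by ring
    have e'' : (m + 1) * k = m * k + k := by ring
    rw [e] at hn ha ⊢
    symm
    rw [← Finset.sum_subset (s₁ := Finset.range (n - (m * k + r * k + k + k) + 1 - a))]
    · refine Finset.sum_congr rfl fun i hi => ?_
      rw [Finset.mem_range] at hi
      have := ih (m + 1) (a + i) (by omega) (by omega)
      rw [e', e''] at this
      rw [this, Nat.add_sub_cancel_left,
        show n - (m * k + k) - (a + i) - 1 = n - m * k - a - k - 1 - i by omega,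
        show n - (m * k + k) - (a + i) - k = n - m * k - a - k - i - k by omega]
      ring
    · rw [Finset.range_subset_range]
      omega
    · intro i hi hi'
      rw [Finset.mem_range] at hi hi'
      by_cases hlt : n - m * k - a - k - 1 - i < k - 1
      · simp [Nat.choose_eq_zero_of_lt hlt]
      · rw [blockLabelingCount_eq_zero (m + 1 + 1) hk (by omega)]
        simp

section Labeling

variable {n k q p : ℕ} {F : Fin q → Finset ℕ}

/-- The labeling `g` records the parts `T` together with the complements of the facets `idx`,
listed in reverse order. -/
def RecordsDecomp (F : Fin q → Finset ℕ) (x : (Fin p → Fin q) × (Fin p → Finset ℕ))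
    (g : ℕ → Option (Fin p × Bool)) : Prop :=
  ∀ y j b, g y = some (j, b) ↔ y ∈ x.2 j.rev ∧ b = decide (y ∉ F (x.1 j.rev))

theorem exists_labeling_of_decomp (hkn : k ≤ n)
    (hfacet : ∀ G : Finset ℕ, (∃ i, F i = G) ↔ G ⊆ Finset.Icc 1 n ∧ G.card = n - k)
    (hlex : ∀ i j : Fin q, i < j →
      List.Lex (· < ·) ((F i).sort (· ≤ ·)) ((F j).sort (· ≤ ·)))
    {x : (Fin p → Fin q) × (Fin p → Finset ℕ)}
    (hx : IsShellingTrappedDecomp F (Finset.Icc 1 n) (Finset.Icc 1 n) p x.1 x.2) :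
    ∃ g ∈ blockLabelings p k (Finset.Icc 1 n) 0, RecordsDecomp F x g := by
  classical
  obtain ⟨idx, T⟩ := x
  obtain ⟨hmono, hdisj, hunion, htrap⟩ := hx
  dsimp only at hmono hdisj hunion htrap
  have hsub : ∀ i, F i ⊆ Finset.Icc 1 n := fun i => ((hfacet _).1 ⟨i, rfl⟩).1
  have hcard : ∀ i, (F i).card = n - k := fun i => ((hfacet _).1 ⟨i, rfl⟩).2
  have hT : ∀ j, T j ⊆ Finset.Icc 1 n := fun j =>
    hunion ▸ Finset.subset_biUnion_of_mem T (Finset.mem_univ j)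
  have hex : ∀ y, y ∈ Finset.Icc 1 n ↔ ∃ j, y ∈ T j := fun y => by
    rw [← hunion]
    simp
  have huniq : ∀ {y j j'}, y ∈ T j → y ∈ T j' → j = j' := by
    intro y j j' h h'
    by_contra hne
    exact Finset.disjoint_left.1 (hdisj j j' hne) h h'
  simp only [shellingG_subset_sdiff_iff hfacet hlex (hT _)] at htrap
  let g : ℕ → Option (Fin p × Bool) := fun y =>
    if h : ∃ j, y ∈ T j then some (h.choose.rev, decide (y ∉ F (idx h.choose))) else none
  have hg : RecordsDecomp F (idx, T) g := by
    intro y j b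
    by_cases h : ∃ j, y ∈ T j
    · simp only [g, dif_pos h, Option.some.injEq, Prod.mk.injEq]
      have hc := h.choose_spec
      constructor
      · rintro ⟨rfl, rfl⟩
        simpa using hc
      · rintro ⟨hy, rfl⟩
        rw [huniq hc hy]
        simp
    · simp only [g, dif_neg h]
      simp only [reduceCtorEq, false_iff, not_and]
      exact fun hy => absurd ⟨_, hy⟩ h
  have hcore : ∀ y j, g y = some (j, true) ↔ y ∈ Finset.Icc 1 n \ F (idx j.rev) := by
    intro y j
    rw [hg]
    constructor
    · rintro ⟨hy, hF⟩
      exact Finset.mem_sdiff.2 ⟨hT _ hy, by simpa using hF⟩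
    · intro hy
      exact ⟨(htrap _).1 hy, by simpa using (Finset.mem_sdiff.1 hy).2⟩
  refine ⟨g, ⟨fun y => ?_, fun j => ?_, fun y j b hy i _ hij => ?_⟩, hg⟩
  · rw [hex]
    simp [g]
  · rw [if_neg (Nat.not_lt_zero _)]
    have : (Finset.Icc 1 n).filter (fun y => g y = some (j, true)) =
        Finset.Icc 1 n \ F (idx j.rev) := by
      ext y
      rw [Finset.mem_filter, hcore, and_iff_right_iff_imp]
      exact fun h => (Finset.mem_sdiff.1 h).1
    rw [this, Finset.card_sdiff_of_subset (hsub _), hcard, Nat.card_Icc]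
    omega
  · obtain ⟨z, hz, hzy⟩ := (htrap _).2 y ((hg y j b).1 hy).1
    simp only [hcore]
    rcases hij.eq_or_lt with rfl | hlt
    · exact ⟨z, hzy, hz⟩
    · obtain ⟨z', hz', hlt'⟩ := exists_lt_of_disjoint_compl hsub hcard hlex
        (hmono (Fin.rev_lt_rev.2 hlt))
        (Finset.disjoint_of_subset_left (htrap _).1 (Finset.disjoint_of_subset_right (htrap _).1
          (hdisj _ _ (Fin.rev_lt_rev.2 hlt).ne))) hz
      exact ⟨z', hlt'.le.trans hzy, hz'⟩

theorem exists_decomp_of_labeling (hk : 1 ≤ k)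
    (hfacet : ∀ G : Finset ℕ, (∃ i, F i = G) ↔ G ⊆ Finset.Icc 1 n ∧ G.card = n - k)
    (hlex : ∀ i j : Fin q, i < j →
      List.Lex (· < ·) ((F i).sort (· ≤ ·)) ((F j).sort (· ≤ ·)))
    {g : ℕ → Option (Fin p × Bool)} (hg : g ∈ blockLabelings p k (Finset.Icc 1 n) 0) :
    ∃ x : (Fin p → Fin q) × (Fin p → Finset ℕ),
      IsShellingTrappedDecomp F (Finset.Icc 1 n) (Finset.Icc 1 n) p x.1 x.2 ∧
        RecordsDecomp F x g := by
  classical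
  obtain ⟨h1, h2, h3⟩ := hg
  have hsub : ∀ i, F i ⊆ Finset.Icc 1 n := fun i => ((hfacet _).1 ⟨i, rfl⟩).1
  have hcard : ∀ i, (F i).card = n - k := fun i => ((hfacet _).1 ⟨i, rfl⟩).2
  have hmem : ∀ {y v}, g y = some v → y ∈ Finset.Icc 1 n := by
    intro y v hy
    by_contra h
    simp [(h1 y).2 h] at hy
  let core : Fin p → Finset ℕ := fun j =>
    (Finset.Icc 1 n).filter (fun y => g y = some (j.rev, true))
  have hcorek : ∀ j, (core j).card = k := fun j => by simpa using h2 j.rev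
  have hidx : ∀ j, ∃ i, F i = Finset.Icc 1 n \ core j := fun j => by
    rw [hfacet, Finset.card_sdiff_of_subset (Finset.filter_subset _ _), Nat.card_Icc, hcorek]
    exact ⟨Finset.sdiff_subset, by omega⟩
  choose idx hidx using hidx
  have hcompl : ∀ j, Finset.Icc 1 n \ F (idx j) = core j := fun j => by
    rw [hidx, Finset.sdiff_sdiff_eq_self (Finset.filter_subset _ _)]
  have hcore : ∀ j y, y ∈ core j ↔ g y = some (j.rev, true) := fun j y => by
    simp only [core, Finset.mem_filter, and_iff_right_iff_imp]
    exact hmem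
  let T : Fin p → Finset ℕ := fun j =>
    (Finset.Icc 1 n).filter (fun y => ∃ b, g y = some (j.rev, b))
  have hT : ∀ j y, y ∈ T j ↔ ∃ b, g y = some (j.rev, b) := fun j y => by
    simp only [T, Finset.mem_filter, and_iff_right_iff_imp]
    rintro ⟨b, h⟩
    exact hmem h
  have hdisj : ∀ j j', j ≠ j' → Disjoint (T j) (T j') := by
    intro j j' hne
    rw [Finset.disjoint_left]
    intro y hy hy'
    obtain ⟨b, hb⟩ := (hT _ _).1 hy
    obtain ⟨b', hb'⟩ := (hT _ _).1 hy'
    rw [hb] at hb'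
    simp only [Option.some.injEq, Prod.mk.injEq, Fin.rev_inj] at hb'
    exact hne hb'.1
  have hcoreT : ∀ j, core j ⊆ T j := fun j y hy => (hT _ _).2 ⟨true, (hcore _ _).1 hy⟩
  have hcoredisj : ∀ j j', j ≠ j' → Disjoint (core j) (core j') := fun j j' hne =>
    Finset.disjoint_of_subset_left (hcoreT _)
      (Finset.disjoint_of_subset_right (hcoreT _) (hdisj j j' hne))
  refine ⟨(idx, T), ⟨fun j j' hjj => ?_, hdisj, ?_, fun j => ?_⟩, fun y j b => ?_⟩
  · refine lt_of_disjoint_compl hsub hcard hlex ?_ ?_ ?_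
    · rw [hcompl, hcompl]
      exact hcoredisj _ _ hjj.ne
    · rw [hcompl, ← Finset.card_pos, hcorek]
      omega
    · intro y hy
      simp only [hcompl] at hy ⊢
      obtain ⟨z, hz, hgz⟩ := h3 y _ _ ((hcore _ _).1 hy) j'.rev (Nat.zero_le _)
        (Fin.rev_le_rev.2 hjj.le)
      have hz' := (hcore _ _).2 hgz
      refine ⟨z, hz', lt_of_le_of_ne hz ?_⟩
      rintro rfl
      exact Finset.disjoint_left.1 (hcoredisj _ _ hjj.ne) hy hz'
  · ext y
    simp only [Finset.mem_biUnion, Finset.mem_univ, true_and, hT]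
    constructor
    · rintro ⟨j, b, h⟩
      exact hmem h
    · intro hy
      cases hgy : g y with
      | none => exact absurd hy ((h1 y).1 hgy)
      | some v => exact ⟨v.1.rev, v.2, by simp⟩
  · rw [shellingG_subset_sdiff_iff hfacet hlex (Finset.filter_subset _ _), hcompl]
    refine ⟨hcoreT j, fun y hy => ?_⟩
    obtain ⟨b, hb⟩ := (hT _ _).1 hy
    obtain ⟨z, hz, hgz⟩ := h3 y _ _ hb j.rev (Nat.zero_le _) le_rfl
    exact ⟨z, (hcore _ _).2 hgz, hz⟩
  · simp only [hT, hidx, Finset.mem_sdiff, hcore, Fin.rev_rev]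
    constructor
    · intro h
      refine ⟨⟨b, h⟩, ?_⟩
      cases b <;> simp [h, -Finset.mem_Icc, hmem h]
    · rintro ⟨⟨b', h⟩, rfl⟩
      cases b' <;> simp [h, -Finset.mem_Icc, hmem h]

theorem RecordsDecomp.labeling_unique {x : (Fin p → Fin q) × (Fin p → Finset ℕ)}
    {g g' : ℕ → Option (Fin p × Bool)} (h : RecordsDecomp F x g) (h' : RecordsDecomp F x g') :
    g = g' := by
  funext y
  ext ⟨j, b⟩
  exact (h y j b).trans (h' y j b).symm

theorem RecordsDecomp.decomp_unique (hinj : Function.Injective F)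
    (hfacet : ∀ G : Finset ℕ, (∃ i, F i = G) ↔ G ⊆ Finset.Icc 1 n ∧ G.card = n - k)
    {x x' : (Fin p → Fin q) × (Fin p → Finset ℕ)} {g : ℕ → Option (Fin p × Bool)}
    (hx : IsShellingTrappedDecomp F (Finset.Icc 1 n) (Finset.Icc 1 n) p x.1 x.2)
    (hx' : IsShellingTrappedDecomp F (Finset.Icc 1 n) (Finset.Icc 1 n) p x'.1 x'.2)
    (h : RecordsDecomp F x g) (h' : RecordsDecomp F x' g) : x = x' := by
  have hT : ∀ {x : (Fin p → Fin q) × (Fin p → Finset ℕ)}, RecordsDecomp F x g →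
      ∀ j y, y ∈ x.2 j ↔ ∃ b, g y = some (j.rev, b) := by
    intro x h j y
    simp [h y]
  have hF : ∀ {x : (Fin p → Fin q) × (Fin p → Finset ℕ)},
      IsShellingTrappedDecomp F (Finset.Icc 1 n) (Finset.Icc 1 n) p x.1 x.2 →
      RecordsDecomp F x g → ∀ j y, y ∈ F (x.1 j) ↔
        y ∈ Finset.Icc 1 n ∧ g y ≠ some (j.rev, true) := by
    intro x hx h j y
    have hsub : F (x.1 j) ⊆ Finset.Icc 1 n := ((hfacet _).1 ⟨_, rfl⟩).1
    rw [Ne, h y, Fin.rev_rev]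
    constructor
    · intro hy
      exact ⟨hsub hy, by simp [hy]⟩
    · rintro ⟨hy, hno⟩
      by_contra hyF
      exact hyF ((hx.2.2.2 j).2 (Finset.mem_sdiff.2 ⟨hy, fun hyT => hno ⟨hyT, by simp [hyF]⟩⟩))
  refine Prod.ext (funext fun j => hinj (Finset.ext fun y => ?_))
    (funext fun j => Finset.ext fun y => ?_)
  · rw [hF hx h, hF hx' h']
  · rw [hT h, hT h']

theorem card_shellingTrappedDecomp (hk : 1 ≤ k) (hkn : k ≤ n) (hinj : Function.Injective F)
    (hfacet : ∀ G : Finset ℕ, (∃ i, F i = G) ↔ G ⊆ Finset.Icc 1 n ∧ G.card = n - k)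
    (hlex : ∀ i j : Fin q, i < j →
      List.Lex (· < ·) ((F i).sort (· ≤ ·)) ((F j).sort (· ≤ ·))) (p : ℕ) :
    Nat.card {x : (Fin p → Fin q) × (Fin p → Finset ℕ) //
        IsShellingTrappedDecomp F (Finset.Icc 1 n) (Finset.Icc 1 n) p x.1 x.2} =
      Nat.card (blockLabelings p k (Finset.Icc 1 n) 0) := by
  choose f hf hrec using fun x : {x : (Fin p → Fin q) × (Fin p → Finset ℕ) //
    IsShellingTrappedDecomp F (Finset.Icc 1 n) (Finset.Icc 1 n) p x.1 x.2} =>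
      exists_labeling_of_decomp hkn hfacet hlex x.2
  refine Nat.card_eq_of_bijective (fun x => (⟨f x, hf x⟩ : blockLabelings p k (Finset.Icc 1 n) 0))
    ⟨fun x x' h => ?_, fun g => ?_⟩
  · have h' : f x = f x' := congrArg Subtype.val h
    exact Subtype.ext ((hrec x).decomp_unique hinj hfacet x.2 x'.2 (h' ▸ hrec x'))
  · obtain ⟨x, hx, hg⟩ := exists_decomp_of_labeling hk hfacet hlex g.2
    exact ⟨⟨x, hx⟩, Subtype.ext ((hrec ⟨x, hx⟩).labeling_unique hg)⟩

end Labeling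

/-- for `2 ≤ k ≤ n` and `1 ≤ p ≤ ⌊n/k⌋`, the number of shelling-trapped
decompositions of `[n]` over `Δ_{n,n-k}` (with the lexicographic shelling) having exactly
`p` parts equals
`Σ_{0 = i_0 ≤ i_1 ≤ ⋯ ≤ i_p = n - pk} Π_{j=0}^{p-1} C(n - jk - i_j - 1, k-1)·(j+1)^{i_{j+1}-i_j}`.
(The weakly increasing sequences are encoded as monotone functions `s : Fin (p+1) → Fin (n+1)`
with `s 0 = 0` and `s p = n - pk`.) -/
theorem statement7 (n k : ℕ) (hk2 : 2 ≤ k) (hkn : k ≤ n)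
    {q : ℕ} (F : Fin q → Finset ℕ) (hinj : Function.Injective F)
    (hsurj : ∀ G : Finset ℕ, IsFacet (deltaNK n k) G ↔ ∃ i, F i = G)
    (hlex : ∀ i j : Fin q, i < j →
      List.Lex (· < ·) ((F i).sort (· ≤ ·)) ((F j).sort (· ≤ ·)))
    (p : ℕ) (hp1 : 1 ≤ p) (hp2 : p ≤ n / k) :
    Nat.card {x : (Fin p → Fin q) × (Fin p → Finset ℕ) //
        IsShellingTrappedDecomp F (Finset.Icc 1 n) (Finset.Icc 1 n) p x.1 x.2} =
      ∑ s ∈ Finset.univ.filter (fun s : Fin (p + 1) → Fin (n + 1) =>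
          (∀ j j' : Fin (p + 1), j ≤ j' → (s j : ℕ) ≤ (s j' : ℕ)) ∧
          (s 0 : ℕ) = 0 ∧ (s (Fin.last p) : ℕ) = n - p * k),
        ∏ j : Fin p,
          Nat.choose (n - (j : ℕ) * k - (s j.castSucc : ℕ) - 1) (k - 1) *
            ((j : ℕ) + 1) ^ ((s j.succ : ℕ) - (s j.castSucc : ℕ)) := by
  have hfacet : ∀ G : Finset ℕ, (∃ i, F i = G) ↔ G ⊆ Finset.Icc 1 n ∧ G.card = n - k :=
    fun G => (hsurj G).symm.trans isFacet_deltaNK_iff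
  have hk : 1 ≤ k := by omega
  have hpn : p * k ≤ n := (Nat.mul_le_mul_right k hp2).trans (Nat.div_mul_le_self n k)
  rw [card_shellingTrappedDecomp hk hkn hinj hfacet hlex,
    card_blockLabelings hk (Finset.Icc 1 n) (zero_add p), Nat.card_Icc, Nat.add_sub_cancel]
  obtain ⟨r, rfl⟩ : ∃ r, p = r + 1 := ⟨p - 1, by omega⟩
  obtain ⟨N, rfl⟩ : ∃ N, n = N + 1 := ⟨n - 1, by omega⟩
  have h := chainSum_eq_blockLabelingCount hk r 0 0 (by simpa using hpn) (Nat.zero_le _)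
  simp only [chainSum, zero_add, zero_mul, Nat.sub_zero, Nat.add_sub_cancel] at h
  rw [blockLabelingCount_succ, zero_mul, zero_add, zero_add, ← h]
end

section
/- Let 1 ≤ a < b < c ≤ n and let M be the rank-3 shifted matroid on [n] indexed by {a, b, c}, whose set of bases is B(M) = {{a′, b′, c′} : 1 ≤ a′ < b′ < c′ ≤ n, a′ ≤ a, b′ ≤ b, c′ ≤ c}; the non-loop elements of M are exactly 1, …, c. Then M is DJS — that is, every permutation w_1, …, w_c of {1, …, c} has some consecutive triple {w_j, w_{j+1}, w_{j+2}} (1 ≤ j ≤ c − 2) belonging to B(M) — if and only if ⌊(c − b)/2⌋ < a. -/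
/-- `B` is a basis of the rank-3 shifted matroid on `[n]` indexed by `{a, b, c}`:
`B = {a', b', c'}` with `1 ≤ a' < b' < c' ≤ n`, `a' ≤ a`, `b' ≤ b`, `c' ≤ c`. -/
def ShiftedBasis (n a b c : ℕ) (B : Finset ℕ) : Prop :=
  ∃ a' b' c' : ℕ, 1 ≤ a' ∧ a' < b' ∧ b' < c' ∧ c' ≤ n ∧ a' ≤ a ∧ b' ≤ b ∧ c' ≤ c ∧
    B = {a', b', c'}

/-- A distinct triple of non-loops with an element `≤ a` and another element `≤ b` is a basis. -/
theorem ShiftedBasis.of_le {n a b c x y z : ℕ} (hab : a < b) (hcn : c ≤ n) (hx : 1 ≤ x) (hy : 1 ≤ y)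
    (hz : 1 ≤ z) (hyc : y ≤ c) (hzc : z ≤ c) (hxc : x ≤ c) (hxy : x ≠ y) (hxz : x ≠ z) (hyz : y ≠ z)
    (hxa : x ≤ a) (hyb : y ≤ b) : ShiftedBasis n a b c {x, y, z} := by
  rcases lt_or_gt_of_ne hxy with h1 | h1 <;> rcases lt_or_gt_of_ne hxz with h2 | h2 <;>
    rcases lt_or_gt_of_ne hyz with h3 | h3
  · exact ⟨x, y, z, by omega, by omega, by omega, by omega, by omega, by omega, by omega, rfl⟩
  · exact ⟨x, z, y, by omega, by omega, by omega, by omega, by omega, by omega, by omega, by grind⟩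
  · omega
  · exact ⟨z, x, y, by omega, by omega, by omega, by omega, by omega, by omega, by omega, by grind⟩
  · exact ⟨y, x, z, by omega, by omega, by omega, by omega, by omega, by omega, by omega, by grind⟩
  · omega
  · exact ⟨y, z, x, by omega, by omega, by omega, by omega, by omega, by omega, by omega, by grind⟩
  · exact ⟨z, y, x, by omega, by omega, by omega, by omega, by omega, by omega, by omega, by grind⟩

/-- A basis contains an element `≤ a` and another element `≤ b`. -/
theorem ShiftedBasis.exists_le {n a b c : ℕ} {B : Finset ℕ} (h : ShiftedBasis n a b c B) :
    ∃ x ∈ B, ∃ y ∈ B, x < y ∧ x ≤ a ∧ y ≤ b := by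
  obtain ⟨a', b', c', -, h1, -, -, h2, h3, -, rfl⟩ := h
  exact ⟨a', by simp, b', by simp, h1, h2, h3⟩

/-- If `v` enumerates `{1, …, c}` and every window containing an element `≤ a` has its other
two elements `> b`, then there are at least `2 * a` elements `> b`. -/
theorem two_mul_le_of_forall_window {a b c : ℕ} (ha : 1 ≤ a) (hab : a < b) (hbc : b < c) {v : ℕ → ℕ}
    (hinj : Set.InjOn v (Finset.range c)) (himg : (Finset.range c).image v = Finset.Icc 1 c)
    (hwin : ∀ j, j + 2 < c → ∀ x y, j ≤ x → x ≤ j + 2 → j ≤ y → y ≤ j + 2 → x ≠ y →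
      v x ≤ a → b < v y) : 2 * a ≤ c - b := by
  obtain ⟨p, hp, hvp⟩ : ∃ p ∈ Finset.range c, v p = b := by
    rw [← Finset.mem_image, himg, Finset.mem_Icc]; omega
  rw [Finset.mem_range] at hp
  set S := (Finset.range c).filter (fun i => v i ≤ a) with hS
  set L := (Finset.range c).filter (fun i => b < v i) with hL
  have hcard (q : ℕ → Prop) [DecidablePred q] : ((Finset.range c).filter (fun i => q (v i))).card =
      ((Finset.Icc 1 c).filter q).card := by
    rw [← himg, Finset.filter_image, Finset.card_image_of_injOn]
    exact hinj.mono (Finset.coe_subset.2 (Finset.filter_subset _ _))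
  have hScard : S.card = a := by
    rw [hS, hcard (fun x => x ≤ a), show (Finset.Icc 1 c).filter (fun x => x ≤ a) = Finset.Icc 1 a by
      ext; simp; omega]
    simp
  have hLcard : L.card = c - b := by
    rw [hL, hcard (fun x => b < x),
      show (Finset.Icc 1 c).filter (fun x => b < x) = Finset.Icc (b + 1) c by ext; simp; omega]
    simp
  have hright (i : ℕ) (hi : v i ≤ a) (hip : i < p) : i + 2 < p ∧ b < v (i + 1) ∧ b < v (i + 2) := by
    have h2 : i + 2 < c := by
      by_contra h
      have := hwin (c - 3) (by omega) i p (by omega) (by omega) (by omega) (by omega) (by omega) hi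
      omega
    have h3 := hwin i h2 i (i + 1) (by omega) (by omega) (by omega) (by omega) (by omega) hi
    have h4 := hwin i h2 i (i + 2) (by omega) (by omega) (by omega) (by omega) (by omega) hi
    refine ⟨?_, h3, h4⟩
    by_contra h
    obtain rfl | rfl : p = i + 1 ∨ p = i + 2 := by omega
    all_goals omega
  have hleft (i : ℕ) (hic : i < c) (hi : v i ≤ a) (hip : p < i) :
      p + 2 < i ∧ b < v (i - 1) ∧ b < v (i - 2) := by
    have h2 : 2 ≤ i := by
      by_contra h
      have := hwin 0 (by omega) i p (by omega) (by omega) (by omega) (by omega) (by omega) hi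
      omega
    have h3 := hwin (i - 2) (by omega) i (i - 1) (by omega) (by omega) (by omega) (by omega)
      (by omega) hi
    have h4 := hwin (i - 2) (by omega) i (i - 2) (by omega) (by omega) (by omega) (by omega)
      (by omega) hi
    refine ⟨?_, h3, h4⟩
    by_contra h
    obtain rfl | rfl : p = i - 1 ∨ p = i - 2 := by omega
    all_goals omega
  have hside (i : ℕ) (hi : i ∈ S) : i < c ∧ v i ≤ a ∧
      ((i + 2 < p ∧ b < v (i + 1) ∧ b < v (i + 2)) ∨ (p + 2 < i ∧ b < v (i - 1) ∧ b < v (i - 2))) := by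
    simp only [hS, Finset.mem_filter, Finset.mem_range] at hi
    refine ⟨hi.1, hi.2, ?_⟩
    rcases lt_trichotomy i p with h | rfl | h
    · exact Or.inl (hright i hi.2 h)
    · omega
    · exact Or.inr (hleft i hi.1 hi.2 h)
  set f : ℕ → ℕ := fun i => if i < p then i + 1 else i - 1 with hf
  set g : ℕ → ℕ := fun i => if i < p then i + 2 else i - 2 with hg
  have hfL : S.image f ⊆ L := by
    intro y hy
    obtain ⟨i, hi, rfl⟩ := Finset.mem_image.1 hy
    have := hside i hi
    simp only [hL, Finset.mem_filter, Finset.mem_range, hf]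
    split_ifs <;> omega
  have hgL : S.image g ⊆ L := by
    intro y hy
    obtain ⟨i, hi, rfl⟩ := Finset.mem_image.1 hy
    have := hside i hi
    simp only [hL, Finset.mem_filter, Finset.mem_range, hg]
    split_ifs <;> omega
  have hfc : (S.image f).card = a := by
    rw [Finset.card_image_of_injOn, hScard]
    intro i hi k hk h
    have h1 := hside i hi
    have h2 := hside k hk
    simp only [hf] at h
    split_ifs at h <;> omega
  have hgc : (S.image g).card = a := by
    rw [Finset.card_image_of_injOn, hScard]
    intro i hi k hk h
    have h1 := hside i hi
    have h2 := hside k hk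
    simp only [hg] at h
    split_ifs at h <;> omega
  have hdisj : Disjoint (S.image f) (S.image g) := by
    rw [Finset.disjoint_left]
    intro y hy hy'
    obtain ⟨i, hi, rfl⟩ := Finset.mem_image.1 hy
    obtain ⟨k, hk, h⟩ := Finset.mem_image.1 hy'
    obtain ⟨hic, hia, hi⟩ := hside i hi
    obtain ⟨hkc, hka, hk⟩ := hside k hk
    simp only [hf, hg] at h
    rcases hi with hi | hi <;> rcases hk with hk | hk
    · rw [if_pos (by omega), if_pos (by omega)] at h
      obtain rfl : i = k + 1 := by omega
      omega
    · split_ifs at h <;> omega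
    · split_ifs at h <;> omega
    · rw [if_neg (by omega), if_neg (by omega)] at h
      obtain rfl : i = k - 1 := by omega
      omega
  have := Finset.card_le_card (Finset.union_subset hfL hgL)
  rw [Finset.card_union_of_disjoint hdisj] at this
  omega

/-- The enumeration of `{1, …, c}` (positions counted from `0`) that lists `a + 1, …, b`, then
`a` blocks made of two elements `> b` followed by one element `≤ a`, then the remaining elements. -/
def blockEnum (a b j : ℕ) : ℕ :=
  if j < b - a then a + 1 + j
  else if b + 2 * a ≤ j then j + 1
  else if (j - (b - a)) % 3 = 2 then (j - (b - a)) / 3 + 1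
  else b + 1 + 2 * ((j - (b - a)) / 3) + (j - (b - a)) % 3

theorem blockEnum_injective {a b : ℕ} (hab : a < b) : Function.Injective (blockEnum a b) := by
  intro i j h
  unfold blockEnum at h
  split_ifs at h <;> omega

theorem blockEnum_mem_Icc {a b c j : ℕ} (hab : a < b) (hc : 2 * a ≤ c - b) (hbc : b < c)
    (hj : j < c) : blockEnum a b j ∈ Finset.Icc 1 c := by
  rw [Finset.mem_Icc]
  unfold blockEnum
  split_ifs <;> omega

theorem blockEnum_window {a b j x y : ℕ} (hab : a < b) (hxj : j ≤ x) (hxj' : x ≤ j + 2)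
    (hyj : j ≤ y) (hyj' : y ≤ j + 2) (hx : blockEnum a b x ≤ a) (hy : blockEnum a b y ≤ b) :
    x = y := by
  unfold blockEnum at hx hy
  split_ifs at hx hy <;> omega

/-- for `1 ≤ a < b < c ≤ n`, the rank-3 shifted matroid on `[n]` indexed
by `{a, b, c}` (whose non-loop elements are exactly `1, …, c`) is DJS — i.e. every
permutation `w_1, …, w_c` of `{1, …, c}` has a consecutive triple that is a basis — if and
only if `⌊(c - b)/2⌋ < a`. -/
theorem statement19 (n a b c : ℕ) (ha : 1 ≤ a) (hab : a < b) (hbc : b < c) (hcn : c ≤ n) :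
    (∀ w : Fin c → ℕ, Function.Injective w → (∀ j, w j ∈ Finset.Icc 1 c) →
        ∃ (j : ℕ) (h : j + 2 < c),
          ShiftedBasis n a b c {w ⟨j, by omega⟩, w ⟨j + 1, by omega⟩, w ⟨j + 2, h⟩}) ↔
      (c - b) / 2 < a := by
  constructor
  · intro H
    by_contra hlt
    obtain ⟨j, h, hB⟩ := H (fun j => blockEnum a b j)
      (fun i j h => Fin.ext (blockEnum_injective hab h))
      (fun j => blockEnum_mem_Icc hab (by omega) hbc j.2)
    obtain ⟨x, hx, y, hy, hxy, hxa, hyb⟩ := hB.exists_le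
    have key (z : ℕ) (hz : z ∈ ({blockEnum a b j, blockEnum a b (j + 1), blockEnum a b (j + 2)} :
        Finset ℕ)) : ∃ k, j ≤ k ∧ k ≤ j + 2 ∧ blockEnum a b k = z := by
      simp only [Finset.mem_insert, Finset.mem_singleton] at hz
      rcases hz with rfl | rfl | rfl
      · exact ⟨j, by omega, by omega, rfl⟩
      · exact ⟨j + 1, by omega, by omega, rfl⟩
      · exact ⟨j + 2, by omega, by omega, rfl⟩
    obtain ⟨k, hk, hk', rfl⟩ := key x hx
    obtain ⟨l, hl, hl', rfl⟩ := key y hy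
    obtain rfl := blockEnum_window hab hk hk' hl hl' hxa hyb
    exact lt_irrefl _ hxy
  · intro hlt w hw hmem
    by_contra! H
    set v : ℕ → ℕ := fun i => if h : i < c then w ⟨i, h⟩ else 0
    have hvw (i : ℕ) (h : i < c) : v i = w ⟨i, h⟩ := dif_pos h
    have hinj : Set.InjOn v (Finset.range c) := by
      intro i hi j hj h
      simp only [Finset.coe_range, Set.mem_Iio] at hi hj
      rw [hvw i hi, hvw j hj] at h
      simpa using hw h
    have hvmem (i : ℕ) (h : i < c) : 1 ≤ v i ∧ v i ≤ c := by
      rw [hvw i h]; exact Finset.mem_Icc.1 (hmem _)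
    have himg : (Finset.range c).image v = Finset.Icc 1 c := by
      refine Finset.eq_of_subset_of_card_le ?_ ?_
      · intro y hy
        obtain ⟨i, hi, rfl⟩ := Finset.mem_image.1 hy
        exact Finset.mem_Icc.2 (hvmem i (Finset.mem_range.1 hi))
      · rw [Finset.card_image_of_injOn hinj]; simp
    have := two_mul_le_of_forall_window ha hab hbc hinj himg (by
      intro j hj x y hx hx' hy hy' hxy hxa
      by_contra! hyb
      obtain ⟨z, hz, hz', hxz, hyz⟩ : ∃ z, j ≤ z ∧ z ≤ j + 2 ∧ x ≠ z ∧ y ≠ z :=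
        ⟨3 * j + 3 - x - y, by omega, by omega, by omega, by omega⟩
      have hne (s t : ℕ) (hs : s < c) (ht : t < c) (hst : s ≠ t) : v s ≠ v t :=
        fun h => hst (hinj (by simpa using hs) (by simpa using ht) h)
      have hx1 := hvmem x (by omega)
      have hy1 := hvmem y (by omega)
      have hz1 := hvmem z (by omega)
      have hB : ShiftedBasis n a b c {v x, v y, v z} :=
        .of_le hab hcn hx1.1 hy1.1 hz1.1 hy1.2 hz1.2 hx1.2 (hne _ _ (by omega) (by omega) hxy)
          (hne _ _ (by omega) (by omega) hxz) (hne _ _ (by omega) (by omega) hyz) hxa hyb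
      refine H j hj ?_
      rw [← hvw, ← hvw, ← hvw]
      convert hB using 1
      have : ({j, j + 1, j + 2} : Finset ℕ) = {x, y, z} := by
        ext t; simp only [Finset.mem_insert, Finset.mem_singleton]; omega
      simpa [Finset.image_insert] using congrArg (Finset.image v) this)
    omega
end
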